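/- Let (W,S) be a finite Coxeter system, let c be a Coxeter element of W obtained as the product of the simple reflections in some fixed order, let s ∈ S, and let c' be the Coxeter element of the standard parabolic subgroup W_⟨s⟩ obtained by deleting s from that defining word for c. Then: (a) every element w ∈ W with w ≤ c' in the absolute order of W lies in W_⟨s⟩; and (b) for all u, v ∈ W_⟨s⟩ with v ≤ c', one has u ≤ v in the absolute order of W_⟨s⟩ (with respect to the reflections of W_⟨s⟩) if and only if u ≤ v in the absolute order of W. Consequently the interval [1,c'] in the absolute order of W_⟨s⟩ is isomorphic, via inclusion, to the interval [1,c'] in the absolute order of W. -/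

import Mathlib

open scoped BigOperators

section Defs

variable {G : Type*} [Group G]

/-- `t` is a reflection with respect to the generating set `S`:
a conjugate of an element of `S`. -/
def IsReflectionOf (S : Set G) (t : G) : Prop :=
  ∃ g : G, ∃ s ∈ S, t = g * s * g⁻¹

/-- The absolute length of `w`: the minimal length of a word in the
reflections (conjugates of elements of `S`) whose product is `w`. -/
noncomputable def absLength (S : Set G) (w : G) : ℕ :=
  sInf {k | ∃ l : List G, (∀ t ∈ l, IsReflectionOf S t) ∧ l.length = k ∧ l.prod = w}

/-- The absolute order: `u ≤ v` iff `ℓ_T(u) + ℓ_T(u⁻¹v) = ℓ_T(v)`. -/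
def absLe (S : Set G) (u v : G) : Prop :=
  absLength S u + absLength S (u⁻¹ * v) = absLength S v

/-- `c` is a Coxeter element with respect to the set `S` of simple reflections:
a product of all the elements of `S`, each occurring exactly once, in some order. -/
def IsCoxeterElementOf (S : Set G) (c : G) : Prop :=
  ∃ l : List G, l.Nodup ∧ (∀ x, x ∈ l ↔ x ∈ S) ∧ l.prod = c

/-- The rank-selected multichain count `C_{(j₁,…,j_m)}(W)`: the number of multichains
`x₁ ≤ ⋯ ≤ x_{m-1}` in the interval `[1,c]` of the absolute order whose sequence of
rank jumps (prepending `1` and appending `c`) is given by `j`. -/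
noncomputable def chainCount (S : Set G) (c : G) {m : ℕ} (j : Fin m → ℕ) : ℕ :=
  Nat.card {y : Fin (m + 1) → G //
    y 0 = 1 ∧ y (Fin.last m) = c ∧
    (∀ i, absLe S (y i) c) ∧
    (∀ i : Fin m, absLe S (y i.castSucc) (y i.succ)) ∧
    (∀ i : Fin m, absLength S (y i.succ) = absLength S (y i.castSucc) + j i)}

end Defs

section Cox

variable {B : Type*} {W : Type*} [Group W] {M : CoxeterMatrix B}

/-- The set of simple reflections of a Coxeter system. -/
def simpleSet (cs : CoxeterSystem M W) : Set W := Set.range cs.simple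

/-- A Coxeter system is irreducible if its set of simple reflections is nonempty and cannot
be partitioned into two nonempty subsets such that every simple reflection in one commutes
with every simple reflection in the other. -/
def IsIrreducibleCS (cs : CoxeterSystem M W) : Prop :=
  Nonempty B ∧
    ∀ A : Set B, (∀ a ∈ A, ∀ b ∈ Aᶜ, Commute (cs.simple a) (cs.simple b)) →
      A = ∅ ∨ A = Set.univ

/-- The standard parabolic subgroup `W_⟨s⟩` generated by the simple reflections
other than `cs.simple s`. -/
def parabolic (cs : CoxeterSystem M W) (s : B) : Subgroup W :=
  Subgroup.closure (Set.range cs.simple \ {cs.simple s})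

/-- The set of simple reflections of the parabolic subgroup `W_⟨s⟩`, viewed as
elements of that subgroup. -/
def parabolicGens (cs : CoxeterSystem M W) (s : B) : Set (parabolic cs s) :=
  {x | (x : W) ∈ Set.range cs.simple \ {cs.simple s}}

end Cox

/-! ### The geometric representation -/

namespace CoxeterMatrix

open Real Polynomial.Chebyshev

variable {B : Type*} [DecidableEq B]

/-- The simple root indexed by `i`, a standard basis vector of `B → ℝ`. -/
def simpleRoot (i : B) : B → ℝ := Pi.single i 1

@[simp] lemma simpleRoot_self (i : B) : simpleRoot i i = 1 := by simp [simpleRoot]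

lemma simpleRoot_of_ne {i j : B} (h : j ≠ i) : simpleRoot i j = 0 := by simp [simpleRoot, h]

lemma simpleRoot_nonneg (i : B) : 0 ≤ simpleRoot i := by
  simp [simpleRoot]

variable [Fintype B] (M : CoxeterMatrix B)

/-- The simple coroot indexed by `i`, the linear form with value `-2 cos (π / M i j)` at the
simple root indexed by `j`. -/
noncomputable def simpleCoroot (i : B) : Module.Dual ℝ (B → ℝ) :=
  ∑ j, (-2 * cos (π / M i j)) • LinearMap.proj j

lemma simpleCoroot_simpleRoot (i j : B) :
    M.simpleCoroot i (simpleRoot j) = -2 * cos (π / M i j) := by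
  simp [simpleCoroot, simpleRoot, Pi.single_apply]

@[simp] lemma simpleCoroot_simpleRoot_self (i : B) : M.simpleCoroot i (simpleRoot i) = 2 := by
  simp [simpleCoroot_simpleRoot]

/-- The simple reflection of `B → ℝ` indexed by `i`. -/
noncomputable def simpleReflection (i : B) : (B → ℝ) ≃ₗ[ℝ] (B → ℝ) :=
  Module.reflection (M.simpleCoroot_simpleRoot_self i)

lemma simpleReflection_apply (i : B) (v : B → ℝ) :
    M.simpleReflection i v = v - M.simpleCoroot i v • simpleRoot i :=
  Module.reflection_apply _ _

/-- Evaluations of Chebyshev polynomials at `2 cos (2π / m)` which vanish for `3 ≤ m`. -/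
lemma chebyshev_S_eval_products_eq_zero {m : ℕ} (hm : 3 ≤ m) :
    (S ℝ (((m : ℤ) - 2) / 2)).eval (2 * cos (2 * π / m)) *
      ((S ℝ (((m : ℤ) - 1) / 2)).eval (2 * cos (2 * π / m)) +
        (S ℝ (((m : ℤ) - 3) / 2)).eval (2 * cos (2 * π / m))) = 0 ∧
    (S ℝ (((m : ℤ) - 1) / 2)).eval (2 * cos (2 * π / m)) *
      ((S ℝ ((m : ℤ) / 2)).eval (2 * cos (2 * π / m)) +
        (S ℝ (((m : ℤ) - 2) / 2)).eval (2 * cos (2 * π / m))) = 0 := by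
  have hm' : (3 : ℝ) ≤ m := by exact_mod_cast hm
  set φ := 2 * π / m with hφ
  have hmφ : (m : ℝ) * φ = 2 * π := by rw [hφ]; field_simp
  have hsin : sin φ ≠ 0 := by
    apply ne_of_gt
    apply sin_pos_of_pos_of_lt_pi
    · positivity
    · rw [hφ, div_lt_iff₀ (by linarith)]
      nlinarith [pi_pos]
  rcases Nat.even_or_odd' m with ⟨k, rfl | rfl⟩
  · have e1 : (((2 * k : ℕ) : ℤ) - 2) / 2 = k - 1 := by lia
    have e2 : (((2 * k : ℕ) : ℤ) - 1) / 2 = k - 1 := by lia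
    have h : (S ℝ ((k : ℤ) - 1)).eval (2 * cos φ) = 0 := by
      have := S_two_mul_real_cos φ ((k : ℤ) - 1)
      push_cast at this hmφ
      rw [show ((k : ℝ) - 1 + 1) * φ = π by linarith, sin_pi] at this
      exact (mul_eq_zero.mp this).resolve_right hsin
    rw [e1, e2, h]
    simp
  · have e1 : (((2 * k + 1 : ℕ) : ℤ) - 2) / 2 = k - 1 := by lia
    have e2 : (((2 * k + 1 : ℕ) : ℤ) - 1) / 2 = k := by lia
    have e3 : (((2 * k + 1 : ℕ) : ℤ) - 3) / 2 = k - 1 := by lia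
    have e4 : (((2 * k + 1 : ℕ) : ℤ)) / 2 = k := by lia
    have h : (S ℝ (k : ℤ)).eval (2 * cos φ) + (S ℝ ((k : ℤ) - 1)).eval (2 * cos φ) = 0 := by
      have h1 := S_two_mul_real_cos φ ((k : ℤ) - 1)
      have h2 := S_two_mul_real_cos φ (k : ℤ)
      push_cast at h1 h2 hmφ
      rw [show ((k : ℝ) + 1) * φ = 2 * π - (k : ℝ) * φ by linarith, sin_two_pi_sub] at h2
      rw [show ((k : ℝ) - 1 + 1) * φ = k * φ by ring] at h1
      have : ((S ℝ (k : ℤ)).eval (2 * cos φ) +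
          (S ℝ ((k : ℤ) - 1)).eval (2 * cos φ)) * sin φ = 0 := by
        rw [add_mul, h1, h2]; ring
      exact (mul_eq_zero.mp this).resolve_right hsin
    rw [e1, e2, e3, e4, h]
    simp

lemma isLiftable_simpleReflection : M.IsLiftable M.simpleReflection := by
  intro i j
  rcases eq_or_ne i j with rfl | hij
  · ext1 v
    rw [M.diagonal, pow_one]
    exact Module.involutive_reflection _ v
  have h1 := M.off_diagonal i j hij
  have hsymm : M j i = M i j := M.symmetric j i
  ext1 v
  have key := Module.reflection_mul_reflection_pow_apply (M.simpleCoroot_simpleRoot_self i)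
    (M.simpleCoroot_simpleRoot_self j) (M i j) v (2 * cos (2 * π / M i j)) (by
      rw [simpleCoroot_simpleRoot, simpleCoroot_simpleRoot, hsymm, mul_div_assoc, cos_two_mul]
      ring)
  refine key.trans ?_
  obtain h0 | h2 | h3 : M i j = 0 ∨ M i j = 2 ∨ 3 ≤ M i j := by lia
  · simp [h0]
  · rw [simpleCoroot_simpleRoot, simpleCoroot_simpleRoot, hsymm, h2]
    simp
    module
  · obtain ⟨e1, e2⟩ := chebyshev_S_eval_products_eq_zero h3
    rw [e1, e2]
    simp

/-- The coefficients of the roots of the dihedral group of order `2 * m` in terms of its simple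
roots. -/
noncomputable def dihedralCoeff (m k : ℕ) : ℝ := (S ℝ ((k : ℤ) - 1)).eval (2 * cos (π / m))

@[simp] lemma dihedralCoeff_zero (m : ℕ) : dihedralCoeff m 0 = 0 := by simp [dihedralCoeff]

@[simp] lemma dihedralCoeff_one (m : ℕ) : dihedralCoeff m 1 = 1 := by simp [dihedralCoeff]

lemma dihedralCoeff_add_two (m k : ℕ) :
    dihedralCoeff m (k + 2) = 2 * cos (π / m) * dihedralCoeff m (k + 1) - dihedralCoeff m k := by
  have h := S_add_two ℝ ((k : ℤ) - 1)
  rw [show (k : ℤ) - 1 + 2 = ((k + 2 : ℕ) : ℤ) - 1 by push_cast; ring,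
    show (k : ℤ) - 1 + 1 = ((k + 1 : ℕ) : ℤ) - 1 by push_cast; ring] at h
  simp only [dihedralCoeff, h, Polynomial.eval_sub, Polynomial.eval_mul, Polynomial.eval_X]

lemma dihedralCoeff_nonneg {m k : ℕ} (hm : m ≠ 1) (hk : m ≠ 0 → k ≤ m) :
    0 ≤ dihedralCoeff m k := by
  rcases Nat.eq_zero_or_pos m with rfl | hpos
  · simp [dihedralCoeff]
  have hm2 : (2 : ℝ) ≤ m := by exact_mod_cast (by lia : 2 ≤ m)
  have hkm : (k : ℝ) ≤ m := by exact_mod_cast hk hpos.ne'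
  have hsin : 0 < sin (π / m) := by
    apply sin_pos_of_pos_of_lt_pi
    · positivity
    · rw [div_lt_iff₀ (by linarith)]
      nlinarith [pi_pos]
  have h := S_two_mul_real_cos (π / m) ((k : ℤ) - 1)
  have h' : 0 ≤ sin ((k : ℝ) * (π / m)) := by
    apply sin_nonneg_of_nonneg_of_le_pi
    · positivity
    · rw [mul_div_assoc', div_le_iff₀ (by linarith)]
      nlinarith [pi_pos]
  push_cast at h
  rw [sub_add_cancel] at h
  rw [← h] at h'
  exact nonneg_of_mul_nonneg_left h' hsin

end CoxeterMatrix

namespace CoxeterSystem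

open CoxeterMatrix

variable {B : Type*} [DecidableEq B] [Fintype B] {W : Type*} [Group W] {M : CoxeterMatrix B}
  (cs : CoxeterSystem M W)

/-- The geometric representation of a Coxeter group. -/
noncomputable def geomRep : W →* ((B → ℝ) ≃ₗ[ℝ] (B → ℝ)) :=
  cs.lift ⟨M.simpleReflection, M.isLiftable_simpleReflection⟩

lemma geomRep_simple (i : B) (v : B → ℝ) :
    cs.geomRep (cs.simple i) v = v - M.simpleCoroot i v • simpleRoot i := by
  rw [geomRep, lift_apply_simple, simpleReflection_apply]

lemma geomRep_simple_simpleRoot (i : B) :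
    cs.geomRep (cs.simple i) (simpleRoot i) = -simpleRoot i := by
  rw [geomRep_simple, simpleCoroot_simpleRoot_self, two_smul]
  abel

lemma geomRep_mul_apply (u w : W) (v : B → ℝ) :
    cs.geomRep (u * w) v = cs.geomRep u (cs.geomRep w v) := by
  rw [map_mul, LinearEquiv.mul_apply]

@[simp] lemma geomRep_one_apply (v : B → ℝ) : cs.geomRep 1 v = v := by simp

lemma geomRep_simple_dihedral {p q : B} (k : ℕ) :
    cs.geomRep (cs.simple q) (dihedralCoeff (M p q) (k + 1) • simpleRoot p +
      dihedralCoeff (M p q) k • simpleRoot q) =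
    dihedralCoeff (M q p) (k + 2) • simpleRoot q +
      dihedralCoeff (M q p) (k + 1) • simpleRoot p := by
  rw [M.symmetric q p, dihedralCoeff_add_two, map_add, map_smul, map_smul,
    geomRep_simple_simpleRoot, geomRep_simple, simpleCoroot_simpleRoot, M.symmetric q p]
  module

lemma geomRep_nonneg_aux (n : ℕ) :
    (∀ (u : W) (p : B), cs.length u = n → cs.length u < cs.length (u * cs.simple p) →
      0 ≤ cs.geomRep u (simpleRoot p)) ∧
    (∀ (u : W) (p q : B) (k : ℕ), cs.length u = n → p ≠ q →
      cs.length (cs.wordProd (alternatingWord q p (k + 1)) * u⁻¹) = cs.length u + (k + 1) →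
      0 ≤ cs.geomRep u (dihedralCoeff (M p q) (k + 1) • simpleRoot p +
        dihedralCoeff (M p q) k • simpleRoot q)) := by
  induction n using Nat.strong_induction_on with
  | _ n ih =>
  have step : ∀ (u : W) (p q : B) (k : ℕ), cs.length u = n → p ≠ q →
      cs.length (u * cs.simple q) < cs.length u →
      cs.length (cs.wordProd (alternatingWord q p (k + 1)) * u⁻¹) = cs.length u + (k + 1) →
      0 ≤ cs.geomRep u (dihedralCoeff (M p q) (k + 1) • simpleRoot p +
        dihedralCoeff (M p q) k • simpleRoot q) := by
    intro u p q k hu hpq hq h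
    have hlen := cs.isRightDescent_iff.mp hq
    have := (ih _ (hu ▸ hq)).2 (u * cs.simple q) q p (k + 1) rfl hpq.symm (by
      rw [alternatingWord_succ, wordProd_concat, mul_inv_rev, inv_simple, mul_assoc,
        cs.simple_mul_simple_cancel_left, h]
      lia)
    rw [← cs.geomRep_simple_dihedral, ← geomRep_mul_apply, mul_assoc, cs.simple_mul_simple_self,
      mul_one] at this
    exact this
  have base : ∀ (u : W) (p : B), cs.length u = n → cs.length u < cs.length (u * cs.simple p) →
      0 ≤ cs.geomRep u (simpleRoot p) := by
    intro u p hu hp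
    rcases eq_or_ne u 1 with rfl | hne
    · simpa using simpleRoot_nonneg p
    obtain ⟨q, hq⟩ := cs.exists_rightDescent_of_ne_one hne
    have hpq : p ≠ q := by
      rintro rfl
      exact lt_asymm hp hq
    have := step u p q 0 hu hpq hq (by
      have h : cs.simple p * u⁻¹ = (u * cs.simple p)⁻¹ := by simp
      rw [alternatingWord_succ, wordProd_concat, alternatingWord, wordProd_nil, one_mul, h,
        length_inv]
      exact cs.not_isRightDescent_iff.mp (not_lt_of_gt hp))
    simpa using this
  refine ⟨base, fun u p q k hu hpq h => ?_⟩
  by_cases hq : cs.length (u * cs.simple q) < cs.length u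
  · exact step u p q k hu hpq hq h
  have hp : cs.length u < cs.length (u * cs.simple p) := by
    have h1 : cs.simple p * u⁻¹ = (u * cs.simple p)⁻¹ := by simp
    have h2 := cs.length_wordProd_le (alternatingWord p q k)
    rw [length_alternatingWord] at h2
    rw [alternatingWord_succ, wordProd_concat, mul_assoc, h1] at h
    have h3 := cs.length_mul_le (cs.wordProd (alternatingWord p q k)) (u * cs.simple p)⁻¹
    rw [length_inv] at h3
    lia
  have hk : M p q ≠ 0 → k + 1 ≤ M p q := by
    intro h0
    by_contra! hlt
    rw [M.symmetric p q] at h0 hlt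
    apply cs.not_isReduced_alternatingWord q p h0 hlt
    have h2 := cs.length_wordProd_le (alternatingWord q p (k + 1))
    have h3 := cs.length_mul_le (cs.wordProd (alternatingWord q p (k + 1))) u⁻¹
    rw [length_inv] at h3
    rw [IsReduced]
    rw [length_alternatingWord] at h2 ⊢
    lia
  rw [map_add, map_smul, map_smul]
  have hm := M.off_diagonal p q hpq
  exact add_nonneg
    (smul_nonneg (dihedralCoeff_nonneg hm hk) (base u p hu hp))
    (smul_nonneg (dihedralCoeff_nonneg hm fun h0 => by have := hk h0; lia)
      (base u q hu (by have := cs.not_isRightDescent_iff.mp hq; lia)))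

/-- If `i` is not a right descent of `w`, then `w` sends the simple root indexed by `i` to a
positive root. -/
theorem geomRep_simpleRoot_nonneg {w : W} {i : B} (h : ¬cs.IsRightDescent w i) :
    0 ≤ cs.geomRep w (simpleRoot i) :=
  (cs.geomRep_nonneg_aux _).1 w i rfl (by have := cs.not_isRightDescent_iff.mp h; lia)

/-- If `i` is a right descent of `w`, then `w` sends the simple root indexed by `i` to a
negative root. -/
theorem geomRep_simpleRoot_nonpos {w : W} {i : B} (h : cs.IsRightDescent w i) :
    cs.geomRep w (simpleRoot i) ≤ 0 := by
  have := cs.geomRep_simpleRoot_nonneg (cs.isRightDescent_iff_not_isRightDescent_mul.mp h)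
  rwa [geomRep_mul_apply, geomRep_simple_simpleRoot, map_neg, Left.nonneg_neg_iff] at this

lemma eq_one_of_geomRep_pos {w : W}
    (h : ∀ i, ∃ k, 0 < cs.geomRep w (simpleRoot i) k) : w = 1 := by
  by_contra hne
  obtain ⟨i, hi⟩ := cs.exists_rightDescent_of_ne_one hne
  obtain ⟨k, hk⟩ := h i
  exact absurd (cs.geomRep_simpleRoot_nonpos hi k) (not_le.mpr hk)

end CoxeterSystem

namespace CoxeterSystem

variable {B : Type*} {W : Type*} [Group W] {M : CoxeterMatrix B} (cs : CoxeterSystem M W)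

lemma ne_of_simple_mem_diff {s j : B} (hj : cs.simple j ∈ Set.range cs.simple \ {cs.simple s}) :
    j ≠ s := by
  rintro rfl
  exact hj.2 rfl

/-- The span of the simple roots other than the one indexed by `s`. -/
def rootHyperplane (s : B) : Submodule ℝ (B → ℝ) := LinearMap.ker (LinearMap.proj s)

lemma mem_rootHyperplane {s : B} {v : B → ℝ} : v ∈ rootHyperplane s ↔ v s = 0 := Iff.rfl

variable {cs} in
lemma parabolic_induction {s : B} {p : (w : W) → w ∈ parabolic cs s → Prop}
    (one : p 1 (one_mem _))
    (simple_mul : ∀ j (hj : cs.simple j ∈ Set.range cs.simple \ {cs.simple s}), ∀ y hy, p y hy →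
      p (cs.simple j * y) (mul_mem (Subgroup.subset_closure hj) hy))
    {w : W} (hw : w ∈ parabolic cs s) : p w hw := by
  induction hw using Subgroup.closure_induction_left with
  | one => exact one
  | mul_left x hx y hy ih =>
    obtain ⟨⟨j, rfl⟩, hj⟩ := hx
    exact simple_mul j ⟨⟨j, rfl⟩, hj⟩ y hy ih
  | inv_mul_cancel x hx y hy ih =>
    obtain ⟨⟨j, rfl⟩, hj⟩ := hx
    simp only [inv_simple]
    exact simple_mul j ⟨⟨j, rfl⟩, hj⟩ y hy ih

end CoxeterSystem

namespace CoxeterSystem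

open CoxeterMatrix Module

variable {B : Type*} [DecidableEq B] [Fintype B] {W : Type*} [Group W] {M : CoxeterMatrix B}
  (cs : CoxeterSystem M W)

lemma simple_injective : Function.Injective cs.simple := by
  intro i j h
  by_contra hij
  have h1 := congrFun (cs.geomRep_simple_simpleRoot i) i
  rw [h, geomRep_simple] at h1
  simp [simpleRoot_of_ne hij] at h1
  linarith

lemma geomRep_conj_simple (g : W) (i : B) (v : B → ℝ) :
    cs.geomRep (g * cs.simple i * g⁻¹) v =
      v - M.simpleCoroot i (cs.geomRep g⁻¹ v) • cs.geomRep g (simpleRoot i) := by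
  rw [geomRep_mul_apply, geomRep_mul_apply, geomRep_simple, map_sub, map_smul,
    ← geomRep_mul_apply, mul_inv_cancel, geomRep_one_apply]

lemma geomRep_simpleRoot_ne_zero (g : W) (i : B) : cs.geomRep g (simpleRoot i) ≠ 0 := by
  rw [Ne, LinearEquiv.map_eq_zero_iff]
  intro h
  simpa using congrFun h i

/-! ### Moved spaces -/

/-- The range of `w - 1` in the geometric representation. -/
noncomputable def movedSpace (w : W) : Submodule ℝ (B → ℝ) :=
  LinearMap.range ((cs.geomRep w : (B → ℝ) →ₗ[ℝ] (B → ℝ)) - LinearMap.id)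

lemma geomRep_sub_mem_movedSpace (w : W) (v : B → ℝ) : cs.geomRep w v - v ∈ cs.movedSpace w :=
  ⟨v, by simp⟩

lemma movedSpace_le_iff {w : W} {p : Submodule ℝ (B → ℝ)} :
    cs.movedSpace w ≤ p ↔ ∀ v, cs.geomRep w v - v ∈ p := by
  refine ⟨fun h v => h (cs.geomRep_sub_mem_movedSpace w v), ?_⟩
  rintro h _ ⟨v, rfl⟩
  simpa using h v

lemma movedSpace_mul_le (u w : W) :
    cs.movedSpace (u * w) ≤ cs.movedSpace u ⊔ cs.movedSpace w := by
  rw [movedSpace_le_iff]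
  intro v
  rw [geomRep_mul_apply, ← sub_add_sub_cancel _ (cs.geomRep w v)]
  exact Submodule.add_mem_sup (cs.geomRep_sub_mem_movedSpace _ _)
    (cs.geomRep_sub_mem_movedSpace _ _)

lemma movedSpace_list_prod_le (L : List W) :
    cs.movedSpace L.prod ≤ ⨆ t ∈ L, cs.movedSpace t := by
  induction L with
  | nil => simp [movedSpace]
  | cons t L ih =>
    simp only [List.prod_cons, List.mem_cons, iSup_or, iSup_sup_eq, iSup_iSup_eq_left]
    exact (cs.movedSpace_mul_le _ _).trans (sup_le_sup_left ih _)

lemma finrank_movedSpace_le_one {t : W} (ht : cs.IsReflection t) :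
    finrank ℝ (cs.movedSpace t) ≤ 1 := by
  obtain ⟨g, i, rfl⟩ := ht
  have h : cs.movedSpace (g * cs.simple i * g⁻¹) ≤ ℝ ∙ cs.geomRep g (simpleRoot i) := by
    rw [movedSpace_le_iff]
    intro v
    rw [geomRep_conj_simple, sub_sub_cancel_left]
    exact neg_mem (Submodule.smul_mem _ _ (Submodule.mem_span_singleton_self _))
  exact (Submodule.finrank_mono h).trans
    (finrank_span_singleton (cs.geomRep_simpleRoot_ne_zero g i)).le

lemma finrank_iSup_movedSpace_le {L : List W} (hL : ∀ t ∈ L, cs.IsReflection t) :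
    finrank ℝ (⨆ t ∈ L, cs.movedSpace t : Submodule ℝ (B → ℝ)) ≤ L.length := by
  induction L with
  | nil => simp
  | cons t L ih =>
    have h : ⨆ u ∈ t :: L, cs.movedSpace u = cs.movedSpace t ⊔ ⨆ u ∈ L, cs.movedSpace u := by
      simp only [List.mem_cons, iSup_or, iSup_sup_eq, iSup_iSup_eq_left]
    rw [h, List.length_cons]
    have h1 := cs.finrank_movedSpace_le_one (hL t List.mem_cons_self)
    have h2 := ih fun t ht => hL t (List.mem_cons_of_mem _ ht)
    have h3 := Submodule.finrank_add_le_finrank_add_finrank (cs.movedSpace t)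
      (⨆ t ∈ L, cs.movedSpace t)
    lia

/-- In a factorization into as few reflections as the dimension of the moved space of the
product, the moved space of each factor is contained in that of the product. -/
lemma movedSpace_le_of_mem_of_length_le {L : List W} (hL : ∀ t ∈ L, cs.IsReflection t)
    (hlen : L.length ≤ finrank ℝ (cs.movedSpace L.prod)) {t : W} (ht : t ∈ L) :
    cs.movedSpace t ≤ cs.movedSpace L.prod := by
  rw [Submodule.eq_of_le_of_finrank_le (cs.movedSpace_list_prod_le L)
    ((cs.finrank_iSup_movedSpace_le hL).trans hlen)]
  exact le_iSup₂_of_le t ht le_rfl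

/-! ### Maximal standard parabolic subgroups -/

lemma simple_mem_parabolic {s j : B} (h : j ≠ s) : cs.simple j ∈ parabolic cs s :=
  Subgroup.subset_closure ⟨⟨j, rfl⟩, fun h' => h (cs.simple_injective h')⟩

lemma movedSpace_le_of_mem_parabolic {s : B} {w : W} (hw : w ∈ parabolic cs s) :
    cs.movedSpace w ≤ rootHyperplane s := by
  induction hw using parabolic_induction with
  | one => simp [movedSpace]
  | simple_mul j hj y _ ih =>
    replace hj := cs.ne_of_simple_mem_diff hj
    refine (cs.movedSpace_mul_le _ _).trans (sup_le ?_ ih)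
    rw [movedSpace_le_iff]
    intro v
    simp [geomRep_simple, mem_rootHyperplane, simpleRoot_of_ne hj.symm]

/-- The parabolic subgroup `W_⟨s⟩` is the stabilizer of the fundamental weight indexed by `s`. -/
theorem mem_parabolic_of_movedSpace_le {s : B} {w : W}
    (hw : cs.movedSpace w ≤ rootHyperplane s) : w ∈ parabolic cs s := by
  induction h : cs.length w using Nat.strong_induction_on generalizing w with
  | _ n ih =>
  rcases eq_or_ne w 1 with rfl | hne
  · exact one_mem _
  obtain ⟨i, hi⟩ := cs.exists_rightDescent_of_ne_one hne
  have his : i ≠ s := by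
    rintro rfl
    have h1 := cs.geomRep_simpleRoot_nonpos hi i
    have h2 := mem_rootHyperplane.mp
      (hw (cs.geomRep_sub_mem_movedSpace w (simpleRoot i)))
    simp only [Pi.sub_apply, simpleRoot_self, Pi.zero_apply] at h1 h2
    linarith
  have hmem := cs.simple_mem_parabolic his
  rw [← Subgroup.mul_mem_cancel_right _ hmem]
  exact ih _ (h ▸ hi) ((cs.movedSpace_mul_le _ _).trans
    (sup_le hw (cs.movedSpace_le_of_mem_parabolic hmem))) rfl

/-- If an element of `W_⟨s⟩` makes a positive root negative, then an element of `W_⟨s⟩` sends this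
root to a simple root, up to a scalar. -/
lemma exists_geomRep_eq_smul_simpleRoot {s : B} {g : W} {i : B}
    (hpos : 0 ≤ cs.geomRep g (simpleRoot i)) {u : W} (hu : u ∈ parabolic cs s)
    (hneg : cs.geomRep u (cs.geomRep g (simpleRoot i)) ≤ 0) :
    ∃ h ∈ parabolic cs s, ∃ p, p ≠ s ∧ ∃ a : ℝ,
      cs.geomRep h (cs.geomRep g (simpleRoot i)) = a • simpleRoot p := by
  induction hu using parabolic_induction with
  | one => exact absurd (le_antisymm (by simpa using hneg) hpos) (cs.geomRep_simpleRoot_ne_zero g i)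
  | simple_mul j hj y hy ih =>
    replace hj := cs.ne_of_simple_mem_diff hj
    by_cases hd : cs.IsRightDescent (y * g) i
    · exact ih (by simpa only [geomRep_mul_apply] using cs.geomRep_simpleRoot_nonpos hd)
    · have h0 := cs.geomRep_simpleRoot_nonneg hd
      rw [geomRep_mul_apply] at h0
      refine ⟨y, hy, j, hj, cs.geomRep y (cs.geomRep g (simpleRoot i)) j, ?_⟩
      rw [geomRep_mul_apply, geomRep_simple] at hneg
      ext k
      rcases eq_or_ne k j with rfl | hk
      · simp
      · have h1 := hneg k
        have h2 := h0 k
        simp only [Pi.sub_apply, Pi.smul_apply, simpleRoot_of_ne hk, smul_zero, sub_zero,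
          Pi.zero_apply] at h1 h2 ⊢
        exact le_antisymm h1 h2

/-- A reflection is determined by its root. -/
lemma conj_simple_eq_simple {g : W} {i p : B} {a : ℝ}
    (h : cs.geomRep g (simpleRoot i) = a • simpleRoot p) :
    g * cs.simple i * g⁻¹ = cs.simple p := by
  have ha : a ≠ 0 := by
    rintro rfl
    exact cs.geomRep_simpleRoot_ne_zero g i (by simpa using h)
  have hinv : cs.geomRep g⁻¹ (simpleRoot p) = a⁻¹ • simpleRoot i := by
    have : simpleRoot p = a⁻¹ • cs.geomRep g (simpleRoot i) := by
      rw [h, smul_smul, inv_mul_cancel₀ ha, one_smul]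
    rw [this, map_smul, ← geomRep_mul_apply, inv_mul_cancel, geomRep_one_apply]
  rw [← cs.inv_simple p, ← mul_eq_one_iff_eq_inv]
  apply cs.eq_one_of_geomRep_pos
  intro j
  have key : ∃ b : ℝ, cs.geomRep (g * cs.simple i * g⁻¹ * cs.simple p) (simpleRoot j) =
      simpleRoot j + b • simpleRoot p := by
    rw [geomRep_mul_apply, geomRep_conj_simple, geomRep_simple, h]
    exact ⟨_, by rw [smul_smul, sub_sub, sub_eq_add_neg, ← add_smul, ← neg_smul]⟩
  rcases eq_or_ne j p with rfl | hj
  · refine ⟨j, ?_⟩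
    rw [geomRep_mul_apply, geomRep_simple_simpleRoot, geomRep_conj_simple, h, map_neg, hinv]
    have h2 : a⁻¹ * 2 * a = 2 := by field_simp
    simp [h2]
  · obtain ⟨b, hb⟩ := key
    refine ⟨j, ?_⟩
    rw [hb]
    simp [simpleRoot_of_ne hj]

/-- A reflection of `W` lying in `W_⟨s⟩` is a reflection of `W_⟨s⟩`. -/
theorem isReflectionOf_parabolicGens {s : B} {t : parabolic cs s}
    (ht : cs.IsReflection (t : W)) : IsReflectionOf (parabolicGens cs s) t := by
  obtain ⟨g, i, hpos, hg⟩ : ∃ g i, 0 ≤ cs.geomRep g (simpleRoot i) ∧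
      (t : W) = g * cs.simple i * g⁻¹ := by
    obtain ⟨g, i, hg⟩ := ht
    by_cases hd : cs.IsRightDescent g i
    · refine ⟨g * cs.simple i, i, cs.geomRep_simpleRoot_nonneg
        (cs.isRightDescent_iff_not_isRightDescent_mul.mp hd), ?_⟩
      simp [hg, mul_assoc]
    · exact ⟨g, i, cs.geomRep_simpleRoot_nonneg hd, hg⟩
  have hneg : cs.geomRep t (cs.geomRep g (simpleRoot i)) ≤ 0 := by
    rw [hg, ← geomRep_mul_apply, inv_mul_cancel_right, geomRep_mul_apply,
      geomRep_simple_simpleRoot, map_neg]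
    exact neg_nonpos.mpr hpos
  obtain ⟨h, hh, p, hp, a, ha⟩ := cs.exists_geomRep_eq_smul_simpleRoot hpos t.2 hneg
  rw [← geomRep_mul_apply] at ha
  have hsp := cs.conj_simple_eq_simple ha
  refine ⟨⟨h, hh⟩⁻¹, ⟨cs.simple p, cs.simple_mem_parabolic hp⟩,
    ⟨⟨p, rfl⟩, fun h' => hp (cs.simple_injective h')⟩, ?_⟩
  ext
  rw [hg]
  simp only [Subgroup.coe_mul, Subgroup.coe_inv, ← hsp]
  group

/-! ### Fixed vectors and Coxeter elements of maximal standard parabolic subgroups -/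

lemma simpleCoroot_eq_zero_of_wordProd_fixed {l : List B} (hl : l.Nodup) {v : B → ℝ}
    (hv : cs.geomRep (cs.wordProd l) v = v) : ∀ i ∈ l, M.simpleCoroot i v = 0 := by
  induction l with
  | nil => simp
  | cons i l ih =>
    obtain ⟨hi, hl'⟩ := List.nodup_cons.mp hl
    have hcoord : cs.geomRep (cs.wordProd l) v i = v i := by
      clear ih hv hl hl'
      induction l with
      | nil => simp
      | cons j l ih =>
        rw [List.mem_cons, not_or] at hi
        rw [wordProd_cons, geomRep_mul_apply, geomRep_simple]
        simp [simpleRoot_of_ne hi.1, ih hi.2]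
    have hs : cs.geomRep (cs.wordProd l) v = cs.geomRep (cs.simple i) v := by
      rw [wordProd_cons] at hv
      nth_rewrite 2 [← hv]
      rw [← geomRep_mul_apply, cs.simple_mul_simple_cancel_left]
    have h0 : M.simpleCoroot i v = 0 := by
      have := congrFun hs i
      rw [hcoord, geomRep_simple] at this
      simp only [Pi.sub_apply, Pi.smul_apply, simpleRoot_self, smul_eq_mul, mul_one] at this
      linarith
    rw [geomRep_simple, h0, zero_smul, sub_zero] at hs
    exact List.forall_mem_cons.mpr ⟨h0, ih hl' hs⟩

lemma eq_zero_of_mem_rootHyperplane_of_fixed [Finite W] (cs : CoxeterSystem M W) {s : B} {v : B → ℝ}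
    (hs : v ∈ rootHyperplane s) (hv : ∀ i, i ≠ s → M.simpleCoroot i v = 0) : v = 0 := by
  have := Fintype.ofFinite (parabolic cs s)
  have hfix : ∀ w : parabolic cs s, cs.geomRep w v = v := by
    rintro ⟨w, hw⟩
    induction hw using parabolic_induction with
    | one => simp
    | simple_mul j hj y _ ih =>
      replace hj := cs.ne_of_simple_mem_diff hj
      simp only at ih
      simp [ih, geomRep_simple, hv j hj]
  let A : (B → ℝ) →ₗ[ℝ] (B → ℝ) := ∑ w : parabolic cs s, (cs.geomRep w).toLinearMap
  have hA : ∀ x, A x = ∑ w : parabolic cs s, cs.geomRep w x := fun x => by simp [A]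
  have hAroot : ∀ j, j ≠ s → A (simpleRoot j) = 0 := by
    intro j hj
    rw [← self_eq_neg, hA]
    conv_lhs => rw [← Equiv.sum_comp (Equiv.mulRight ⟨cs.simple j, cs.simple_mem_parabolic hj⟩)]
    simp [geomRep_simple_simpleRoot]
  have hvsum : v = ∑ j, v j • simpleRoot j := by
    ext k
    simp [simpleRoot, Pi.single_apply]
  have h0 : A v = 0 := by
    rw [hvsum, map_sum]
    refine Finset.sum_eq_zero fun j _ => ?_
    rw [map_smul]
    rcases eq_or_ne j s with rfl | hj
    · rw [mem_rootHyperplane.mp hs, zero_smul]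
    · rw [hAroot j hj, smul_zero]
  rw [hA, Finset.sum_congr rfl fun w _ => hfix w, Finset.sum_const, Finset.card_univ,
    ← Nat.cast_smul_eq_nsmul ℝ] at h0
  exact (smul_eq_zero.mp h0).resolve_left (by exact_mod_cast Fintype.card_ne_zero)

/-- The moved space of a Coxeter element of `W_⟨s⟩` has the largest possible dimension. -/
lemma length_filter_le_finrank_movedSpace [Finite W] {l : List B} (hnd : l.Nodup)
    (hall : ∀ b, b ∈ l) (s : B) :
    (l.filter (· ≠ s)).length ≤
      finrank ℝ (cs.movedSpace (cs.wordProd (l.filter (· ≠ s)))) := by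
  set c := cs.wordProd (l.filter (· ≠ s)) with hc
  let f : (B → ℝ) →ₗ[ℝ] (B → ℝ) := (cs.geomRep c).toLinearMap - LinearMap.id
  have hinj : Function.Injective (f.domRestrict (rootHyperplane s)) := by
    rw [← LinearMap.ker_eq_bot, LinearMap.ker_eq_bot']
    rintro ⟨v, hv⟩ h
    have hfix : cs.geomRep c v = v := by simpa [f, sub_eq_zero] using h
    have := cs.simpleCoroot_eq_zero_of_wordProd_fixed (hnd.filter _) hfix
    exact Subtype.ext (cs.eq_zero_of_mem_rootHyperplane_of_fixed hv fun i hi =>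
      this i (by simp [hall, hi]))
  have hrange : LinearMap.range (f.domRestrict (rootHyperplane s)) ≤ cs.movedSpace c := by
    rintro _ ⟨v, rfl⟩
    exact ⟨v, rfl⟩
  have h1 := Submodule.finrank_mono hrange
  rw [LinearMap.finrank_range_of_inj hinj] at h1
  refine le_trans ?_ h1
  have h2 := LinearMap.finrank_range_add_finrank_ker (LinearMap.proj s : (B → ℝ) →ₗ[ℝ] ℝ)
  have h3 : finrank ℝ (LinearMap.range (LinearMap.proj s : (B → ℝ) →ₗ[ℝ] ℝ)) ≤ 1 := by
    simpa using Submodule.finrank_le (LinearMap.range (LinearMap.proj s : (B → ℝ) →ₗ[ℝ] ℝ))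
  have h4 : (l.filter (· ≠ s)).length + 1 ≤ Fintype.card B := by
    have hnd' : (s :: l.filter (· ≠ s)).Nodup := List.nodup_cons.mpr ⟨by simp, hnd.filter _⟩
    simpa using hnd'.length_le_card
  rw [finrank_fintype_fun_eq_card] at h2
  change _ ≤ finrank ℝ (LinearMap.ker (LinearMap.proj s : (B → ℝ) →ₗ[ℝ] ℝ))
  lia

end CoxeterSystem

/-! ### Absolute length -/

section AbsoluteLength

variable {G : Type*} [Group G] {S : Set G}

lemma IsReflectionOf.of_mem {t : G} (ht : t ∈ S) : IsReflectionOf S t := ⟨1, t, ht, by simp⟩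

lemma absLength_prod_le {L : List G} (hL : ∀ t ∈ L, IsReflectionOf S t) :
    absLength S L.prod ≤ L.length :=
  Nat.sInf_le ⟨L, hL, rfl, rfl⟩

/-- For a generating set closed under inverses, the absolute length of an element is attained
by a factorization into reflections. -/
lemma exists_list_length_eq_absLength (hS : Subgroup.closure S = ⊤) (hinv : ∀ t ∈ S, t⁻¹ ∈ S)
    (w : G) : ∃ L : List G, (∀ t ∈ L, IsReflectionOf S t) ∧ L.length = absLength S w ∧
      L.prod = w := by
  have hw : w ∈ Submonoid.closure (S ∪ S⁻¹) := by
    rw [← Subgroup.closure_toSubmonoid, hS]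
    exact Subgroup.mem_top w
  obtain ⟨L, hL, hprod⟩ := Submonoid.exists_list_of_mem_closure hw
  refine Nat.sInf_mem (s := {k | ∃ l : List G, (∀ t ∈ l, IsReflectionOf S t) ∧
    l.length = k ∧ l.prod = w}) ⟨L.length, L, fun t ht => .of_mem ?_, rfl, hprod⟩
  exact (hL t ht).elim id fun h => inv_inv t ▸ hinv _ h

lemma absLength_mul_le (hS : Subgroup.closure S = ⊤) (hinv : ∀ t ∈ S, t⁻¹ ∈ S) (u v : G) :
    absLength S (u * v) ≤ absLength S u + absLength S v := by
  obtain ⟨L, hL, hlen, rfl⟩ := exists_list_length_eq_absLength hS hinv u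
  obtain ⟨L', hL', hlen', rfl⟩ := exists_list_length_eq_absLength hS hinv v
  rw [← hlen, ← hlen', ← List.prod_append, ← List.length_append]
  exact absLength_prod_le fun t ht => (List.mem_append.mp ht).elim (hL t) (hL' t)

lemma absLength_le_add (hS : Subgroup.closure S = ⊤) (hinv : ∀ t ∈ S, t⁻¹ ∈ S) (u v : G) :
    absLength S v ≤ absLength S u + absLength S (u⁻¹ * v) := by
  simpa using absLength_mul_le hS hinv u (u⁻¹ * v)

end AbsoluteLength

namespace CoxeterSystem

open CoxeterMatrix Module

section

variable {B : Type*} {W : Type*} [Group W] {M : CoxeterMatrix B} (cs : CoxeterSystem M W)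

lemma isReflectionOf_simpleSet {t : W} : IsReflectionOf (simpleSet cs) t ↔ cs.IsReflection t := by
  simp [IsReflectionOf, simpleSet, IsReflection]

lemma closure_simpleSet : Subgroup.closure (simpleSet cs) = ⊤ :=
  cs.subgroup_closure_range_simple

lemma inv_mem_simpleSet : ∀ t ∈ simpleSet cs, t⁻¹ ∈ simpleSet cs := by
  rintro _ ⟨i, rfl⟩
  exact ⟨i, by simp⟩

lemma closure_parabolicGens (s : B) : Subgroup.closure (parabolicGens cs s) = ⊤ :=
  Subgroup.closure_closure_coe_preimage

lemma inv_mem_parabolicGens (s : B) : ∀ t ∈ parabolicGens cs s, t⁻¹ ∈ parabolicGens cs s := by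
  rintro t ⟨⟨i, hi⟩, ht⟩
  have h : t⁻¹ = t := Subtype.ext (by simp [← hi])
  rw [h]
  exact ⟨⟨i, hi⟩, ht⟩

lemma absLength_simpleSet_le {s : B} (u : parabolic cs s) :
    absLength (simpleSet cs) (u : W) ≤ absLength (parabolicGens cs s) u := by
  obtain ⟨L, hL, hlen, rfl⟩ :=
    exists_list_length_eq_absLength (cs.closure_parabolicGens s) (cs.inv_mem_parabolicGens s) u
  rw [← hlen, ← L.length_map (parabolic cs s).subtype, ← Subgroup.coe_subtype, map_list_prod]
  refine absLength_prod_le ?_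
  simp only [List.mem_map]
  rintro _ ⟨t, ht, rfl⟩
  obtain ⟨g, x, hx, rfl⟩ := hL t ht
  exact ⟨g, x, hx.1, by simp⟩

lemma absLength_simpleSet_wordProd_le (l : List B) :
    absLength (simpleSet cs) (cs.wordProd l) ≤ l.length := by
  rw [← l.length_map cs.simple]
  refine absLength_prod_le fun t ht => .of_mem ?_
  obtain ⟨i, -, rfl⟩ := List.mem_map.mp ht
  exact ⟨i, rfl⟩

end

variable {B : Type*} [DecidableEq B] [Fintype B] {W : Type*} [Group W] {M : CoxeterMatrix B}
  (cs : CoxeterSystem M W)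

lemma absLength_parabolicGens_prod_le {s : B} {L : List W} (hL : ∀ t ∈ L, cs.IsReflection t)
    (hmem : ∀ t ∈ L, t ∈ parabolic cs s) {u : parabolic cs s} (hu : (u : W) = L.prod) :
    absLength (parabolicGens cs s) u ≤ L.length := by
  obtain ⟨L, rfl⟩ : ∃ L' : List (parabolic cs s), L'.map (parabolic cs s).subtype = L :=
    ⟨L.attachWith _ hmem, by simp⟩
  obtain rfl : u = L.prod := Subtype.ext (by simpa using hu)
  rw [List.length_map]
  exact absLength_prod_le fun t ht =>
    cs.isReflectionOf_parabolicGens (hL t (List.mem_map_of_mem ht))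

/-- Below an element of `W_⟨s⟩` whose moved space has dimension at least its absolute length, every
factor of a length-additive factorization lies in `W_⟨s⟩` and has the same absolute length there. -/
lemma exists_absLength_parabolicGens_eq {s : B} {c : W} (hc : c ∈ parabolic cs s) {L : List W}
    (hL : L.prod = c)
    (hlen : (L.map (absLength (simpleSet cs))).sum ≤ finrank ℝ (cs.movedSpace c)) :
    ∀ x ∈ L, ∃ u : parabolic cs s, (u : W) = x ∧
      absLength (parabolicGens cs s) u = absLength (simpleSet cs) x := by
  choose f hf hflen hfprod using
    exists_list_length_eq_absLength cs.closure_simpleSet cs.inv_mem_simpleSet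
  have hprod : (L.flatMap f).prod = c := by
    rw [List.flatMap, List.prod_flatten, List.map_map]
    simp [Function.comp_def, hfprod, hL]
  have hrefl : ∀ t ∈ L.flatMap f, cs.IsReflection t := by
    intro t ht
    obtain ⟨x, -, ht⟩ := List.mem_flatMap.mp ht
    exact cs.isReflectionOf_simpleSet.mp (hf x t ht)
  have hmem : ∀ t ∈ L.flatMap f, t ∈ parabolic cs s := by
    intro t ht
    refine cs.mem_parabolic_of_movedSpace_le
      ((cs.movedSpace_le_of_mem_of_length_le hrefl ?_ ht).trans ?_)
    · rw [hprod]
      simpa [List.length_flatMap, hflen] using hlen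
    · rw [hprod]
      exact cs.movedSpace_le_of_mem_parabolic hc
  intro x hx
  have hsub : ∀ t ∈ f x, t ∈ L.flatMap f := fun t ht => List.mem_flatMap.mpr ⟨x, hx, ht⟩
  have hx' : x ∈ parabolic cs s := by
    rw [← hfprod x]
    exact list_prod_mem fun t ht => hmem t (hsub t ht)
  refine ⟨⟨x, hx'⟩, rfl, le_antisymm ?_ (cs.absLength_simpleSet_le ⟨x, hx'⟩)⟩
  rw [← hflen]
  exact cs.absLength_parabolicGens_prod_le (fun t ht => hrefl t (hsub t ht))
    (fun t ht => hmem t (hsub t ht)) (hfprod x).symm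

end CoxeterSystem

/-- **Lemma (the interval `[1,c']` in `W_⟨s⟩` and in `W`).**
Let `c` be the Coxeter element of `W` given by the word `l` (an enumeration of the simple
reflections), let `s ∈ S`, and let `c'` be the Coxeter element of `W_⟨s⟩` obtained by
deleting `s` from the word `l`.  Then (a) every `w ∈ W` with `w ≤ c'` in the absolute order
of `W` lies in `W_⟨s⟩`; (b) for `u, v ∈ W_⟨s⟩` with `v ≤ c'` (in the absolute order of
`W_⟨s⟩`), `u ≤ v` in the absolute order of `W_⟨s⟩` iff `u ≤ v` in the absolute order of `W`;
and consequently (c) the inclusion is a bijection from the interval `[1,c']` in the absolute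
order of `W_⟨s⟩` onto the interval `[1,c']` in the absolute order of `W`. -/
theorem parabolic_interval
    {B : Type} [DecidableEq B] [Fintype B] {W : Type} [Group W] [Fintype W]
    {M : CoxeterMatrix B} (cs : CoxeterSystem M W)
    (l : List B) (hnd : l.Nodup) (hall : ∀ b : B, b ∈ l)
    (c : W) (hc : c = cs.wordProd l)
    (s : B)
    (c' : parabolic cs s) (hc' : (c' : W) = cs.wordProd (l.filter (· ≠ s))) :
    (∀ w : W, absLe (simpleSet cs) w (c' : W) → w ∈ parabolic cs s) ∧
    (∀ u v : parabolic cs s, absLe (parabolicGens cs s) v c' →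
      (absLe (parabolicGens cs s) u v ↔ absLe (simpleSet cs) (u : W) (v : W))) ∧
    (∀ w : W, absLe (simpleSet cs) w (c' : W) ↔
      ∃ u : parabolic cs s, absLe (parabolicGens cs s) u c' ∧ (u : W) = w) := by
  have hlen : absLength (simpleSet cs) (c' : W) ≤ Module.finrank ℝ (cs.movedSpace (c' : W)) := by
    rw [hc']
    exact (cs.absLength_simpleSet_wordProd_le _).trans
      (cs.length_filter_le_finrank_movedSpace hnd hall s)
  have hle : ∀ x : parabolic cs s,
      absLength (simpleSet cs) (x : W) ≤ absLength (parabolicGens cs s) x :=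
    fun x => cs.absLength_simpleSet_le x
  have htri : ∀ x y : parabolic cs s, absLength (simpleSet cs) (y : W) ≤
      absLength (simpleSet cs) (x : W) + absLength (simpleSet cs) ((x : W)⁻¹ * y) :=
    fun x y => absLength_le_add cs.closure_simpleSet cs.inv_mem_simpleSet x y
  have hfactor := fun L : List W => cs.exists_absLength_parabolicGens_eq c'.2 (L := L)
  have heq : ∀ (L : List W) (x : parabolic cs s), L.prod = c' →
      (L.map (absLength (simpleSet cs))).sum ≤ absLength (simpleSet cs) (c' : W) → (x : W) ∈ L →
      absLength (parabolicGens cs s) x = absLength (simpleSet cs) (x : W) := by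
    intro L x hL hsum hx
    obtain ⟨y, hy, h⟩ := hfactor L hL (hsum.trans hlen) x hx
    rwa [Subtype.ext hy] at h
  have hc'len := heq [(c' : W)] c' (by simp) (by simp) (by simp)
  have hdown : ∀ w : W, absLe (simpleSet cs) w (c' : W) → w ∈ parabolic cs s := by
    intro w hw
    obtain ⟨u, rfl, -⟩ := hfactor [w, w⁻¹ * c'] (by simp)
      (by simpa using hw.le.trans hlen) w (by simp)
    exact u.2
  have hiff : ∀ u : parabolic cs s,
      absLe (parabolicGens cs s) u c' ↔ absLe (simpleSet cs) (u : W) (c' : W) := by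
    intro u
    constructor <;> intro h
    · have h1 := hle u
      have h2 := hle (u⁻¹ * c')
      have h3 := htri u c'
      simp only [absLe, Subgroup.coe_mul, Subgroup.coe_inv] at *
      lia
    · have h1 := heq [(u : W), (u : W)⁻¹ * c'] u (by simp) (by simpa using h.le) (by simp)
      have h2 := heq [(u : W), (u : W)⁻¹ * c'] (u⁻¹ * c') (by simp) (by simpa using h.le) (by simp)
      simp only [absLe, Subgroup.coe_mul, Subgroup.coe_inv] at *
      lia
  refine ⟨hdown, fun u v hv => ?_, fun w => ⟨fun h => ⟨⟨w, hdown w h⟩, (hiff _).mpr h, rfl⟩, ?_⟩⟩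
  · rw [hiff] at hv
    have hvlen := heq [(v : W), (v : W)⁻¹ * c'] v (by simp) (by simpa using hv.le) (by simp)
    constructor <;> intro h
    · have h1 := hle u
      have h2 := hle (u⁻¹ * v)
      have h3 := htri u v
      simp only [absLe, Subgroup.coe_mul, Subgroup.coe_inv] at *
      lia
    · have hsum : absLength (simpleSet cs) (u : W) + (absLength (simpleSet cs) ((u : W)⁻¹ * v) +
          absLength (simpleSet cs) ((v : W)⁻¹ * c')) ≤ absLength (simpleSet cs) (c' : W) := by
        simp only [absLe] at h hv
        lia
      have h1 := heq [(u : W), (u : W)⁻¹ * v, (v : W)⁻¹ * c'] u (by simp) (by simpa using hsum)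
        (by simp)
      have h2 := heq [(u : W), (u : W)⁻¹ * v, (v : W)⁻¹ * c'] (u⁻¹ * v) (by simp)
        (by simpa using hsum) (by simp)
      simp only [absLe, Subgroup.coe_mul, Subgroup.coe_inv] at *
      lia
  · rintro ⟨u, hu, rfl⟩
    exact (hiff u).mp hu
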